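/- Let M be a multisegment and let e be the largest element of E(M). Then every segment of M^# whose ending equals e is contained, as a set, in the set of elements of E(M) (i.e., the segments of M^# ending with e are constructed exclusively with points from E(M)). -/

import Mathlib

open scoped Classical

noncomputable section

/-- The segment `{a, a+1, ..., a+m-1}` as a finite set of reals. -/
def finsetSeg (a : ℝ) (m : ℕ) : Finset ℝ :=
  (Finset.range m).image (fun i => a + i)

/-- A segment is a nonempty subset of `ℝ` of the form `{a, a+1, ..., a+m-1}` with `m ≥ 1`. -/
def IsSegment (S : Finset ℝ) : Prop :=
  ∃ (a : ℝ) (m : ℕ), 1 ≤ m ∧ S = finsetSeg a m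

/-- A multisegment is a nonempty finite multiset of segments. -/
def IsMultisegment (M : Multiset (Finset ℝ)) : Prop :=
  M ≠ 0 ∧ ∀ S ∈ M, IsSegment S

/-- The beginning (smallest element) of a segment. -/
def beg (S : Finset ℝ) : ℝ := if h : S.Nonempty then S.min' h else 0

/-- The ending (largest element) of a segment. -/
def endg (S : Finset ℝ) : ℝ := if h : S.Nonempty then S.max' h else 0

/-- Two segments are linked if neither is included in the other and their union is a segment. -/
def Linked (S₁ S₂ : Finset ℝ) : Prop :=
  ¬ S₁ ⊆ S₂ ∧ ¬ S₂ ⊆ S₁ ∧ IsSegment (S₁ ∪ S₂)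

/-- `ElemOp M N` means that `N` is obtained from `M` by an elementary operation:
a pair of linked segments `S₁, S₂` of `M` is replaced by `S₁ ∪ S₂, S₁ ∩ S₂`,
the intersection being omitted when empty. -/
def ElemOp (M N : Multiset (Finset ℝ)) : Prop :=
  ∃ (S₁ S₂ : Finset ℝ) (rest : Multiset (Finset ℝ)),
    Linked S₁ S₂ ∧ M = S₁ ::ₘ S₂ ::ₘ rest ∧
    N = (if S₁ ∩ S₂ = ∅ then (S₁ ∪ S₂) ::ₘ rest
         else (S₁ ∪ S₂) ::ₘ (S₁ ∩ S₂) ::ₘ rest)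

/-- `msLE M M'` (i.e. `M ≤ M'`) : `M` is obtained from `M'` by a finite (possibly empty)
sequence of elementary operations. -/
def msLE (M M' : Multiset (Finset ℝ)) : Prop :=
  Relation.ReflTransGen ElemOp M' M

/-- The support of a multisegment: the multiset union of its segments. -/
def suppM (M : Multiset (Finset ℝ)) : Multiset ℝ :=
  (M.map Finset.val).sum

/-- The maxlength `m(M)`: the maximal length of the segments of `M`. -/
def maxLen (M : Multiset (Finset ℝ)) : ℕ :=
  (M.map Finset.card).sup

/-- The thickness `t(M)`: the number of segments of `M`, counted with multiplicity. -/
def thickness (M : Multiset (Finset ℝ)) : ℕ := Multiset.card M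

/-- The largest element of `E(M)`, the multiset of endings of the segments of `M`. -/
def maxEnd (M : Multiset (Finset ℝ)) : ℝ :=
  ((M.map endg).toFinset.max).unbotD 0

/-- The candidate segments of `M` with ending `x` which are not included in `prev`. -/
def cands (M : Multiset (Finset ℝ)) (x : ℝ) (prev : Finset ℝ) : Finset (Finset ℝ) :=
  M.toFinset.filter (fun S => endg S = x ∧ ¬ S ⊆ prev)

/-- A shortest element of a finite collection of finite sets (junk value `∅` if empty).
In the Moeglin-Waldspurger algorithm the candidate sets consist of segments with a
common ending, so a shortest candidate is unique and this choice is canonical. -/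
def chooseMin (C : Finset (Finset ℝ)) : Finset ℝ :=
  if h : C.Nonempty then (Finset.exists_min_image C Finset.card h).choose else ∅

/-- The chain `δ₀, δ₁, δ₂, ...` of the Moeglin-Waldspurger algorithm: `δ₀` is a shortest
segment of `M` with ending `x` (the maximal ending), and `δ_i` is a shortest segment of
`M` with ending `x - i` not included in `δ_{i-1}`; the construction stops when no such
segment exists.  The first argument is fuel (the chain has length at most `card M`). -/
def mwChainAux (M : Multiset (Finset ℝ)) : ℕ → ℝ → Finset ℝ → List (Finset ℝ)
  | 0, _, _ => []
  | n + 1, x, prev =>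
      if (cands M x prev).Nonempty then
        chooseMin (cands M x prev) :: mwChainAux M n (x - 1) (chooseMin (cands M x prev))
      else []

/-- The chain `δ₀, δ₁, ..., δ_r` of the Moeglin-Waldspurger algorithm for `M`. -/
def mwChain (M : Multiset (Finset ℝ)) : List (Finset ℝ) :=
  mwChainAux M (Multiset.card M) (maxEnd M) ∅

/-- The first segment `S₀ = {e-r, ..., e}` of `M^#`, where `e = maxEnd M` and
`r + 1` is the length of the chain. -/
def firstSeg (M : Multiset (Finset ℝ)) : Finset ℝ :=
  finsetSeg (maxEnd M - (((mwChain M).length - 1 : ℕ) : ℝ)) (mwChain M).length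

/-- `δ⁻`: the segment `δ` with its ending removed. -/
def segMinus (S : Finset ℝ) : Finset ℝ := S.erase (endg S)

/-- `M⁻`: the multisegment obtained from `M` by replacing each `δ_i` of the chain by
`δ_i⁻`, erasing it if it becomes empty. -/
def msMinus (M : Multiset (Finset ℝ)) : Multiset (Finset ℝ) :=
  (mwChain M).foldl
    (fun N δ => if segMinus δ = ∅ then N.erase δ else segMinus δ ::ₘ N.erase δ) M

/-- Fuelled version of the Moeglin-Waldspurger algorithm.  Each round extracts the first
segment `S₀` and recurses on `M⁻`; on a genuine multisegment each round strictly decreases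
the cardinality of the support, so fuel `card (suppM M)` always suffices. -/
def mwaAux : ℕ → Multiset (Finset ℝ) → Multiset (Finset ℝ)
  | 0, _ => 0
  | n + 1, M => if M = 0 then 0 else firstSeg M ::ₘ mwaAux n (msMinus M)

/-- The Moeglin-Waldspurger algorithm `M ↦ M^#`. -/
def mwa (M : Multiset (Finset ℝ)) : Multiset (Finset ℝ) :=
  mwaAux (Multiset.card (suppM M)) M

/-- The staircase multisegment `M(a; l, k)`: the `k` segments
`{a+i, a+i+1, ..., a+i+l-1}` for `i = 1, ..., k` (`k` segments of length `l`,
each a shift by `1` of the previous one). -/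
def staircase (a : ℝ) (l k : ℕ) : Multiset (Finset ℝ) :=
  (Multiset.range k).map (fun i => finsetSeg (a + i + 1) l)

theorem finsetSeg_eq_image (a : ℝ) (m : ℕ) :
    finsetSeg a m = (Finset.range m).image (fun i : ℕ => a + (i : ℝ)) := by
  ext x
  simp [finsetSeg, eq_neg_add_iff_add_eq]

theorem card_finsetSeg (a : ℝ) (m : ℕ) : (finsetSeg a m).card = m := by
  rw [finsetSeg_eq_image, Finset.card_image_of_injective, Finset.card_range]
  intro i j h
  simpa using h

theorem mem_finsetSeg_iff {a x : ℝ} {m : ℕ} :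
    x ∈ finsetSeg a m ↔ ∃ j < m, x = a + m - 1 - (j : ℕ) := by
  simp only [finsetSeg_eq_image, Finset.mem_image, Finset.mem_range]
  constructor
  · rintro ⟨i, hi, rfl⟩
    refine ⟨m - 1 - i, by omega, ?_⟩
    have : ((m - 1 - i : ℕ) : ℝ) + i + 1 = m := by
      exact_mod_cast (by omega : (m - 1 - i) + i + 1 = m)
    linarith
  · rintro ⟨j, hj, rfl⟩
    refine ⟨m - 1 - j, by omega, ?_⟩
    have : ((m - 1 - j : ℕ) : ℝ) + j + 1 = m := by
      exact_mod_cast (by omega : (m - 1 - j) + j + 1 = m)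
    linarith

theorem endg_finsetSeg (a : ℝ) {m : ℕ} (hm : 1 ≤ m) :
    endg (finsetSeg a m) = a + m - 1 := by
  have hmem : a + m - 1 ∈ finsetSeg a m := mem_finsetSeg_iff.2 ⟨0, hm, by simp⟩
  have hne : (finsetSeg a m).Nonempty := ⟨_, hmem⟩
  rw [endg, dif_pos hne]
  refine le_antisymm (Finset.max'_le _ _ _ fun y hy => ?_) (Finset.le_max' _ _ hmem)
  obtain ⟨j, -, rfl⟩ := mem_finsetSeg_iff.1 hy
  have : (0 : ℝ) ≤ j := Nat.cast_nonneg j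
  linarith

theorem segMinus_finsetSeg (a : ℝ) (m : ℕ) :
    segMinus (finsetSeg a (m + 1)) = finsetSeg a m := by
  ext x
  rw [segMinus, endg_finsetSeg a (by omega), Finset.mem_erase, mem_finsetSeg_iff,
    mem_finsetSeg_iff]
  push_cast
  constructor
  · rintro ⟨hx, j, hj, rfl⟩
    rcases j with _ | j
    · simp at hx
    · exact ⟨j, by omega, by push_cast; ring⟩
  · rintro ⟨j, hj, rfl⟩
    have : (0 : ℝ) ≤ j := Nat.cast_nonneg j
    exact ⟨by linarith, j + 1, by omega, by push_cast; ring⟩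

theorem IsSegment.segMinus {S : Finset ℝ} (hS : IsSegment S) (h : segMinus S ≠ ∅) :
    IsSegment (segMinus S) ∧ endg (segMinus S) = endg S - 1 := by
  obtain ⟨a, m, hm, rfl⟩ := hS
  obtain ⟨k, rfl⟩ := Nat.exists_eq_add_of_le' hm
  rw [segMinus_finsetSeg] at h ⊢
  have hk : 1 ≤ k := by
    by_contra hk
    obtain rfl : k = 0 := by omega
    exact h (by simp [finsetSeg])
  refine ⟨⟨a, k, hk, rfl⟩, ?_⟩
  rw [endg_finsetSeg a hk, endg_finsetSeg a hm]
  push_cast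
  ring

theorem IsSegment.subset_of_card_le {S T : Finset ℝ} (hS : IsSegment S) (hT : IsSegment T)
    (hend : endg S = endg T) (hcard : S.card ≤ T.card) : S ⊆ T := by
  obtain ⟨a, m, hm, rfl⟩ := hS
  obtain ⟨b, k, hk, rfl⟩ := hT
  rw [endg_finsetSeg a hm, endg_finsetSeg b hk] at hend
  rw [card_finsetSeg, card_finsetSeg] at hcard
  intro x hx
  obtain ⟨j, hj, rfl⟩ := mem_finsetSeg_iff.1 hx
  exact mem_finsetSeg_iff.2 ⟨j, by omega, by rw [hend]⟩

theorem mem_cands {M : Multiset (Finset ℝ)} {x : ℝ} {prev S : Finset ℝ} :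
    S ∈ cands M x prev ↔ S ∈ M ∧ endg S = x ∧ ¬ S ⊆ prev := by
  simp [cands]

theorem chooseMin_mem {C : Finset (Finset ℝ)} (h : C.Nonempty) : chooseMin C ∈ C := by
  rw [chooseMin, dif_pos h]
  exact (Finset.exists_min_image C Finset.card h).choose_spec.1

theorem card_chooseMin_le {C : Finset (Finset ℝ)} {S : Finset ℝ} (hS : S ∈ C) :
    (chooseMin C).card ≤ S.card := by
  have h : C.Nonempty := ⟨S, hS⟩
  rw [chooseMin, dif_pos h]
  exact (Finset.exists_min_image C Finset.card h).choose_spec.2 S hS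

theorem endg_le_maxEnd {M : Multiset (Finset ℝ)} {S : Finset ℝ} (hS : S ∈ M) :
    endg S ≤ maxEnd M := by
  have hmem : endg S ∈ (M.map endg).toFinset :=
    Multiset.mem_toFinset.2 (Multiset.mem_map_of_mem _ hS)
  obtain ⟨b, hb⟩ := Finset.max_of_mem hmem
  rw [maxEnd, hb]
  exact Finset.le_max_of_eq hmem hb

theorem exists_endg_eq_maxEnd {M : Multiset (Finset ℝ)} (hM : M ≠ 0) :
    ∃ S ∈ M, endg S = maxEnd M := by
  obtain ⟨S, hS⟩ := Multiset.exists_mem_of_ne_zero hM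
  have hmem : endg S ∈ (M.map endg).toFinset :=
    Multiset.mem_toFinset.2 (Multiset.mem_map_of_mem _ hS)
  obtain ⟨b, hb⟩ := Finset.max_of_mem hmem
  obtain ⟨T, hT, hTb⟩ := Multiset.mem_map.1 (Multiset.mem_toFinset.1 (Finset.mem_of_max hb))
  exact ⟨T, hT, by rw [maxEnd, hb]; exact hTb⟩

theorem mem_and_endg_le_of_mem_mwChainAux {M : Multiset (Finset ℝ)} {δ : Finset ℝ} :
    ∀ {n : ℕ} {x : ℝ} {prev : Finset ℝ}, δ ∈ mwChainAux M n x prev → δ ∈ M ∧ endg δ ≤ x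
  | 0, _, _, h => by simp [mwChainAux] at h
  | n + 1, x, prev, h => by
    rw [mwChainAux] at h
    split_ifs at h with hC
    · rcases List.mem_cons.1 h with rfl | h
      · obtain ⟨hM, hx, -⟩ := mem_cands.1 (chooseMin_mem hC)
        exact ⟨hM, hx.le⟩
      · obtain ⟨hM, hx⟩ := mem_and_endg_le_of_mem_mwChainAux h
        exact ⟨hM, by linarith⟩
    · simp at h

theorem nodup_mwChainAux (M : Multiset (Finset ℝ)) :
    ∀ (n : ℕ) (x : ℝ) (prev : Finset ℝ), (mwChainAux M n x prev).Nodup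
  | 0, _, _ => by simp [mwChainAux]
  | n + 1, x, prev => by
    rw [mwChainAux]
    split_ifs with hC
    · refine List.nodup_cons.2 ⟨fun h => ?_, nodup_mwChainAux M n _ _⟩
      have h₁ := (mem_cands.1 (chooseMin_mem hC)).2.1
      have h₂ := (mem_and_endg_le_of_mem_mwChainAux h).2
      linarith
    · exact List.nodup_nil

theorem exists_endg_eq_of_lt_length_mwChainAux (M : Multiset (Finset ℝ)) :
    ∀ (n : ℕ) (x : ℝ) (prev : Finset ℝ) (j : ℕ), j < (mwChainAux M n x prev).length →
      ∃ S ∈ M, endg S = x - j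
  | 0, _, _, j, h => by simp [mwChainAux] at h
  | n + 1, x, prev, j, h => by
    rw [mwChainAux] at h
    split_ifs at h with hC
    · rcases j with _ | j
      · obtain ⟨hM, hx, -⟩ := mem_cands.1 (chooseMin_mem hC)
        exact ⟨_, hM, by simpa using hx⟩
      · obtain ⟨S, hS, hx⟩ :=
          exists_endg_eq_of_lt_length_mwChainAux M n _ _ j (by simpa using h)
        exact ⟨S, hS, by rw [hx]; push_cast; ring⟩
    · simp at h

/-- If every segment of `N` comes from `M` or from shortening a segment of the chain of `M`,
then the chain of `N` is no longer than that of `M`.  The middle alternative of the hypothesis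
accounts for the shortening of the previous segment `prev` of the chain of `M`. -/
theorem length_mwChainAux_le {M N : Multiset (Finset ℝ)} (hM : ∀ S ∈ M, IsSegment S)
    (hN : ∀ S ∈ N, S.Nonempty) :
    ∀ {n k : ℕ} {x : ℝ} {prev prev' : Finset ℝ}, k ≤ n → prev ⊆ prev' →
      (∀ S ∈ N, endg S ≤ x → S ∈ M ∨ (endg S = x ∧ S ⊆ prev) ∨
        ∃ δ ∈ mwChainAux M n x prev, S = segMinus δ) →
      (mwChainAux N k x prev').length ≤ (mwChainAux M n x prev).length
  | _, 0, _, _, _, _, _, _ => by simp [mwChainAux]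
  | 0, k + 1, _, _, _, h, _, _ => by omega
  | n + 1, k + 1, x, prev, prev', hkn, hprev, H => by
    have hlow {δ S : Finset ℝ} {y : ℝ} {l : ℕ} {p : Finset ℝ} (hS : S ∈ N)
        (hδ : δ ∈ mwChainAux M l y p) (h : S = segMinus δ) : endg S ≤ y - 1 := by
      obtain ⟨hδM, hy⟩ := mem_and_endg_le_of_mem_mwChainAux hδ
      have := ((hM δ hδM).segMinus (h ▸ (hN S hS).ne_empty)).2
      rw [h, this]
      linarith
    by_cases hC' : (cands N x prev').Nonempty
    · have hT := chooseMin_mem hC'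
      rw [mwChainAux, if_pos hC']
      set T := chooseMin (cands N x prev')
      obtain ⟨hTN, hTx, hTp⟩ := mem_cands.1 hT
      have hTM : T ∈ M := by
        rcases H T hTN hTx.le with h | ⟨-, h⟩ | ⟨δ, hδ, h⟩
        · exact h
        · exact absurd (h.trans hprev) hTp
        · have := hlow hTN hδ h
          linarith
      have hTC : T ∈ cands M x prev := mem_cands.2 ⟨hTM, hTx, fun h => hTp (h.trans hprev)⟩
      have hC : (cands M x prev).Nonempty := ⟨T, hTC⟩
      have hD := chooseMin_mem hC
      have hcard := card_chooseMin_le hTC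
      rw [mwChainAux, if_pos hC] at H ⊢
      set D := chooseMin (cands M x prev)
      obtain ⟨hDM, hDx, -⟩ := mem_cands.1 hD
      have hDT : D ⊆ T :=
        (hM D hDM).subset_of_card_le (hM T hTM) (hDx.trans hTx.symm) hcard
      rw [List.length_cons, List.length_cons]
      refine Nat.succ_le_succ (length_mwChainAux_le hM hN (by omega) hDT fun S hS hSx => ?_)
      rcases H S hS (by linarith) with h | ⟨h, -⟩ | ⟨δ, hδ, h⟩
      · exact Or.inl h
      · linarith
      · rcases List.mem_cons.1 hδ with rfl | hδ
        · refine Or.inr (Or.inl ⟨?_, h ▸ Finset.erase_subset _ _⟩)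
          rw [h, ((hM _ hDM).segMinus (h ▸ (hN S hS).ne_empty)).2, hDx]
        · exact Or.inr (Or.inr ⟨δ, hδ, h⟩)
    · rw [mwChainAux, if_neg hC']
      simp

theorem mwChain_le (M : Multiset (Finset ℝ)) : (mwChain M : Multiset (Finset ℝ)) ≤ M :=
  (Multiset.le_iff_subset (Multiset.coe_nodup.2 (nodup_mwChainAux M _ _ _))).2 fun _ h =>
    (mem_and_endg_le_of_mem_mwChainAux (Multiset.mem_coe.1 h)).1

theorem card_msMinus_le (M : Multiset (Finset ℝ)) :
    Multiset.card (msMinus M) ≤ Multiset.card M := by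
  suffices ∀ (l : List (Finset ℝ)) (N : Multiset (Finset ℝ)), (l : Multiset (Finset ℝ)) ≤ N →
      Multiset.card (l.foldl (fun N δ => if segMinus δ = ∅ then N.erase δ
        else segMinus δ ::ₘ N.erase δ) N) ≤ Multiset.card N from this _ _ (mwChain_le M)
  intro l
  induction l with
  | nil => intro N _; simp
  | cons δ l ih =>
    intro N hN
    have hδ : δ ∈ N := Multiset.mem_of_le hN (by simp)
    have hl : (l : Multiset (Finset ℝ)) ≤ N.erase δ := by
      simpa using Multiset.erase_le_erase δ hN
    have hcard := Multiset.card_erase_add_one hδ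
    rw [List.foldl_cons]
    split_ifs
    · have := ih _ hl
      omega
    · have := ih _ (hl.trans (Multiset.le_cons_self _ (segMinus δ)))
      rw [Multiset.card_cons] at this
      omega

theorem mem_msMinus {M : Multiset (Finset ℝ)} {S : Finset ℝ} (hS : S ∈ msMinus M) :
    S ∈ M ∨ (S ≠ ∅ ∧ ∃ δ ∈ mwChain M, S = segMinus δ) := by
  suffices ∀ (l : List (Finset ℝ)) (N : Multiset (Finset ℝ)),
      S ∈ l.foldl (fun N δ => if segMinus δ = ∅ then N.erase δ
        else segMinus δ ::ₘ N.erase δ) N →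
      S ∈ N ∨ (S ≠ ∅ ∧ ∃ δ ∈ l, S = segMinus δ) from this _ _ hS
  intro l
  induction l with
  | nil => intro N h; exact Or.inl h
  | cons δ l ih =>
    intro N h
    rw [List.foldl_cons] at h
    rcases ih _ h with h | ⟨hne, D, hD, h⟩
    · split_ifs at h with h0
      · exact Or.inl (Multiset.mem_of_mem_erase h)
      · rcases Multiset.mem_cons.1 h with h | h
        · exact Or.inr ⟨h ▸ h0, δ, List.mem_cons_self, h⟩
        · exact Or.inl (Multiset.mem_of_mem_erase h)
    · exact Or.inr ⟨hne, D, List.mem_cons_of_mem _ hD, h⟩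

theorem isSegment_of_mem_msMinus {M : Multiset (Finset ℝ)} (hM : ∀ S ∈ M, IsSegment S)
    {S : Finset ℝ} (hS : S ∈ msMinus M) : IsSegment S := by
  rcases mem_msMinus hS with h | ⟨hne, δ, hδ, rfl⟩
  · exact hM S h
  · exact ((hM δ (mem_and_endg_le_of_mem_mwChainAux hδ).1).segMinus hne).1

theorem IsSegment.nonempty {S : Finset ℝ} (hS : IsSegment S) : S.Nonempty := by
  obtain ⟨a, m, hm, rfl⟩ := hS
  rw [← Finset.card_pos, card_finsetSeg]
  exact hm

theorem maxEnd_msMinus_le {M : Multiset (Finset ℝ)} (hM : ∀ S ∈ M, IsSegment S)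
    (h0 : msMinus M ≠ 0) : maxEnd (msMinus M) ≤ maxEnd M := by
  obtain ⟨S, hS, hSe⟩ := exists_endg_eq_maxEnd h0
  rw [← hSe]
  rcases mem_msMinus hS with h | ⟨hne, δ, hδ, rfl⟩
  · exact endg_le_maxEnd h
  · obtain ⟨hδM, hδe⟩ := mem_and_endg_le_of_mem_mwChainAux hδ
    rw [((hM δ hδM).segMinus hne).2]
    linarith

theorem length_mwChain_msMinus_le {M : Multiset (Finset ℝ)} (hM : ∀ S ∈ M, IsSegment S)
    (he : maxEnd (msMinus M) = maxEnd M) :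
    (mwChain (msMinus M)).length ≤ (mwChain M).length := by
  rw [mwChain, he]
  refine length_mwChainAux_le hM (fun S hS => (isSegment_of_mem_msMinus hM hS).nonempty)
    (card_msMinus_le M) subset_rfl fun S hS _ => ?_
  rcases mem_msMinus hS with h | ⟨-, h⟩
  · exact Or.inl h
  · exact Or.inr (Or.inr h)

theorem one_le_length_mwChain {M : Multiset (Finset ℝ)} (hM : ∀ S ∈ M, IsSegment S)
    (h0 : M ≠ 0) : 1 ≤ (mwChain M).length := by
  obtain ⟨S, hS, hSe⟩ := exists_endg_eq_maxEnd h0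
  obtain ⟨k, hk⟩ := Nat.exists_eq_succ_of_ne_zero (mt Multiset.card_eq_zero.1 h0)
  have hC : (cands M (maxEnd M) ∅).Nonempty :=
    ⟨S, mem_cands.2 ⟨hS, hSe, fun h => (hM S hS).nonempty.ne_empty (Finset.subset_empty.1 h)⟩⟩
  rw [mwChain, hk, mwChainAux, if_pos hC]
  simp

theorem mem_firstSeg_iff {M : Multiset (Finset ℝ)} {x : ℝ} :
    x ∈ firstSeg M ↔ ∃ j < (mwChain M).length, x = maxEnd M - (j : ℕ) := by
  rw [firstSeg, mem_finsetSeg_iff]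
  refine exists_congr fun j => and_congr_right fun hj => ?_
  rw [Nat.cast_sub (by omega)]
  push_cast
  ring_nf

theorem endg_firstSeg {M : Multiset (Finset ℝ)} (hM : ∀ S ∈ M, IsSegment S) (h0 : M ≠ 0) :
    endg (firstSeg M) = maxEnd M := by
  have h := one_le_length_mwChain hM h0
  rw [firstSeg, endg_finsetSeg _ h, Nat.cast_sub h]
  push_cast
  ring

theorem firstSeg_msMinus_subset {M : Multiset (Finset ℝ)} (hM : ∀ S ∈ M, IsSegment S)
    (he : maxEnd (msMinus M) = maxEnd M) : firstSeg (msMinus M) ⊆ firstSeg M := by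
  intro x hx
  obtain ⟨j, hj, rfl⟩ := mem_firstSeg_iff.1 hx
  exact mem_firstSeg_iff.2 ⟨j, hj.trans_le (length_mwChain_msMinus_le hM he), by rw [he]⟩

/-- Among the segments produced by the algorithm, the first one has the largest ending and
contains all those with the same ending. -/
theorem endg_le_and_subset_firstSeg_of_mem_mwaAux {T : Finset ℝ} :
    ∀ {n : ℕ} {M : Multiset (Finset ℝ)}, (∀ S ∈ M, IsSegment S) → T ∈ mwaAux n M →
      endg T ≤ maxEnd M ∧ (endg T = maxEnd M → T ⊆ firstSeg M)
  | 0, _, _, hT => by simp [mwaAux] at hT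
  | n + 1, M, hM, hT => by
    rw [mwaAux] at hT
    split_ifs at hT with h0
    · simp at hT
    rcases Multiset.mem_cons.1 hT with rfl | hT
    · exact ⟨(endg_firstSeg hM h0).le, fun _ => subset_rfl⟩
    have h0' : msMinus M ≠ 0 := by
      intro h
      rw [h] at hT
      cases n <;> simp [mwaAux] at hT
    obtain ⟨hle, hsub⟩ := endg_le_and_subset_firstSeg_of_mem_mwaAux
      (fun _ hS => isSegment_of_mem_msMinus hM hS) hT
    have hmax := maxEnd_msMinus_le hM h0'
    refine ⟨hle.trans hmax, fun he => ?_⟩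
    exact (hsub (le_antisymm hle (hmax.trans he.ge))).trans
      (firstSeg_msMinus_subset hM (le_antisymm hmax (he.ge.trans hle)))

/-- Let `e` be the largest element of `E(M)`.  Every segment of `M^#` whose ending
equals `e` is contained, as a set, in the set of elements of `E(M)`: it is constructed
exclusively with points from `E(M)`. -/
theorem mwa_top_segments_made_of_endings (M : Multiset (Finset ℝ))
    (hM : IsMultisegment M) :
    ∀ T ∈ mwa M, endg T = maxEnd M → ∀ x ∈ T, ∃ S ∈ M, endg S = x := by
  intro T hT he x hx
  obtain ⟨j, hj, rfl⟩ :=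
    mem_firstSeg_iff.1 ((endg_le_and_subset_firstSeg_of_mem_mwaAux hM.2 hT).2 he hx)
  exact exists_endg_eq_of_lt_length_mwChainAux M _ _ _ j hj
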